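/- Obstruction to RMPS being approximate 2-designs: let n ≥ 2 be even, d ≥ 2, D ≥ 1, and let A := {1,…,n/2} and B := {n/2+1,…,n} be the two halves of the chain. Let ν be a Borel probability measure on unit vectors in (ℂ^d)^{⊗n} such that ν-almost every ψ has Schmidt rank at most D across the bipartition A|B. If ‖ E_{ψ∼ν} (|ψ⟩⟨ψ|)^{⊗2} − 2·P_sym/(d^n(d^n+1)) ‖_F ≤ ε, then ε ≥ d^{−n} ( 1/D − 2·d^{n/2}/(d^n+1) ). -/

import Mathlib

open MeasureTheory Matrix
open scoped ComplexConjugate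

noncomputable section


/-- Merge a configuration on `A` with a configuration on `Aᶜ` into a full configuration. -/
def mergeCfg {n d : ℕ} (A : Finset (Fin n)) (x : (i : A) → Fin d)
    (z : (i : (Aᶜ : Finset (Fin n))) → Fin d) : Fin n → Fin d :=
  fun i => if h : i ∈ A then x ⟨i, h⟩ else z ⟨i, Finset.mem_compl.mpr h⟩

/-- The (unnormalized) reduced density matrix `ρ_A = Tr_{A^c}[|ψ⟩⟨ψ|]` of a vector
`ψ ∈ (ℂ^d)^{⊗n}` on the sites in `A`. -/
def rhoA {n d : ℕ} (A : Finset (Fin n)) (ψ : (Fin n → Fin d) → ℂ) :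
    Matrix ((i : A) → Fin d) ((i : A) → Fin d) ℂ :=
  Matrix.of fun x y =>
    ∑ z : (i : (Aᶜ : Finset (Fin n))) → Fin d, ψ (mergeCfg A x z) * conj (ψ (mergeCfg A y z))

/-- `η(x,y) := (x y² − x)/(x² y² − 1)`. -/
def etaF (x y : ℝ) : ℝ := (x * y ^ 2 - x) / (x ^ 2 * y ^ 2 - 1)

/-- The operator `(|ψ⟩⟨ψ|)^{⊗2}` on `(ℂ^d)^{⊗n} ⊗ (ℂ^d)^{⊗n}`, written entrywise. -/
def pureTwo {d n : ℕ} (ψ : (Fin n → Fin d) → ℂ) :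
    Matrix ((Fin n → Fin d) × (Fin n → Fin d)) ((Fin n → Fin d) × (Fin n → Fin d)) ℂ :=
  Matrix.of fun p q => ψ p.1 * ψ p.2 * conj (ψ q.1) * conj (ψ q.2)

/-- The swap operator on `H ⊗ H` with `H = (ℂ^d)^{⊗n}`, exchanging the two copies. -/
def swapBig (d n : ℕ) :
    Matrix ((Fin n → Fin d) × (Fin n → Fin d)) ((Fin n → Fin d) × (Fin n → Fin d)) ℂ :=
  Matrix.of fun p q => if p.1 = q.2 ∧ p.2 = q.1 then 1 else 0

/-- The orthogonal projector `P_sym = (1 + 𝔽)/2` onto the symmetric subspace of `H ⊗ H`,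
i.e. the `+1` eigenspace of the swap operator. -/
def symProj (d n : ℕ) :
    Matrix ((Fin n → Fin d) × (Fin n → Fin d)) ((Fin n → Fin d) × (Fin n → Fin d)) ℂ :=
  (2 : ℂ)⁻¹ • (1 + swapBig d n)

/-- The Frobenius (Hilbert–Schmidt) norm of a matrix. -/
def frobNorm {ι : Type*} [Fintype ι] (X : Matrix ι ι ℂ) : ℝ :=
  Real.sqrt (∑ p, ∑ q, ‖X p q‖ ^ 2)

/-- The type of unit vectors in `(ℂ^d)^{⊗n}`. -/
abbrev UnitVec (d n : ℕ) := {ψ : (Fin n → Fin d) → ℂ // ∑ x, ‖ψ x‖ ^ 2 = 1}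

/-- The second moment operator `E_{ψ∼ν} (|ψ⟩⟨ψ|)^{⊗2}`, written entrywise. -/
def momentTwo {d n : ℕ} (ν : Measure (UnitVec d n)) :
    Matrix ((Fin n → Fin d) × (Fin n → Fin d)) ((Fin n → Fin d) × (Fin n → Fin d)) ℂ :=
  Matrix.of fun p q => ∫ ψ, pureTwo ψ.1 p q ∂ν

theorem aux_purity {α : Type*} [Fintype α] [DecidableEq α] (ρ : Matrix α α ℂ)
    (h : ρ.IsHermitian) (htr : ρ.trace = 1) (D : ℕ) (hD : 1 ≤ D) (hr : ρ.rank ≤ D) :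
    1 / (D : ℝ) ≤ ∑ x, ∑ y, ‖ρ x y‖ ^ 2 := by
  have h1 : ∑ i, h.eigenvalues i = 1 := by
    have := h.trace_eq_sum_eigenvalues
    rw [htr] at this
    have h' : ((∑ i, h.eigenvalues i : ℝ) : ℂ) = 1 := by
      rw [this]; push_cast; rfl
    exact_mod_cast h'
  have h2 : ((∑ x, ∑ y, ‖ρ x y‖ ^ 2 : ℝ) : ℂ) = (ρ * ρ).trace := by
    simp only [Matrix.trace, Matrix.diag, Matrix.mul_apply]
    push_cast
    refine Finset.sum_congr rfl fun x _ => Finset.sum_congr rfl fun y _ => ?_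
    rw [← h.apply y x, ← Complex.mul_conj']
    rfl
  have h3 : (ρ * ρ).trace = ((∑ i, h.eigenvalues i ^ 2 : ℝ) : ℂ) := by
    conv_lhs => rw [h.spectral_theorem]
    rw [← map_mul, Unitary.conjStarAlgAut_apply, Matrix.trace_mul_cycle]
    simp [Matrix.trace, Matrix.diagonal_mul_diagonal, sq]
  have h4 : ∑ x, ∑ y, ‖ρ x y‖ ^ 2 = ∑ i, h.eigenvalues i ^ 2 := by
    exact_mod_cast h2.trans h3
  rw [h4]
  have hcard := h.rank_eq_card_non_zero_eigs
  rw [Fintype.card_subtype] at hcard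
  set s := Finset.univ.filter fun i => h.eigenvalues i ≠ 0 with hs
  have h5 : ∑ i ∈ s, h.eigenvalues i = 1 := by
    rw [← h1]
    exact Finset.sum_filter_ne_zero _
  have h6 := sq_sum_le_card_mul_sum_sq (s := s) (f := h.eigenvalues)
  rw [h5] at h6
  have h7 : ∑ i ∈ s, h.eigenvalues i ^ 2 ≤ ∑ i, h.eigenvalues i ^ 2 :=
    Finset.sum_le_sum_of_subset_of_nonneg (Finset.subset_univ _) fun _ _ _ => sq_nonneg _
  have h8 : (s.card : ℝ) ≤ D := by rw [← hcard]; exact_mod_cast hr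
  have h9 : 0 ≤ ∑ i ∈ s, h.eigenvalues i ^ 2 := Finset.sum_nonneg fun _ _ => sq_nonneg _
  have hD' : (0 : ℝ) < D := by exact_mod_cast hD
  rw [div_le_iff₀ hD']
  nlinarith [mul_le_mul h8 h7 h9 hD'.le]

/-- The partial-swap functional. -/
def auxS {α β γ : Type*} [Fintype α] [Fintype β] (e : α × β ≃ γ)
    (X : Matrix (γ × γ) (γ × γ) ℂ) : ℂ :=
  ∑ t : (α × α) × (β × β), X (e (t.1.1, t.2.1), e (t.1.2, t.2.2)) (e (t.1.2, t.2.1), e (t.1.1, t.2.2))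

theorem auxS_le {α β γ : Type*} [Fintype α] [Fintype β] [Fintype γ] (e : α × β ≃ γ)
    (X : Matrix (γ × γ) (γ × γ) ℂ) : ‖auxS e X‖ ≤ Fintype.card γ * frobNorm X := by
  have hc : Fintype.card γ = Fintype.card α * Fintype.card β := by
    rw [← Fintype.card_congr e, Fintype.card_prod]
  have h1 : ‖auxS e X‖ ≤ ∑ t : (α × α) × (β × β), ‖X (e (t.1.1, t.2.1), e (t.1.2, t.2.2)) (e (t.1.2, t.2.1), e (t.1.1, t.2.2))‖ :=
    norm_sum_le _ _
  refine h1.trans ?_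
  have h2 := sq_sum_le_card_mul_sum_sq (s := (Finset.univ : Finset ((α × α) × (β × β))))
    (f := fun t => ‖X (e (t.1.1, t.2.1), e (t.1.2, t.2.2)) (e (t.1.2, t.2.1), e (t.1.1, t.2.2))‖)
  have h3 : ∑ t : (α × α) × (β × β), ‖X (e (t.1.1, t.2.1), e (t.1.2, t.2.2)) (e (t.1.2, t.2.1), e (t.1.1, t.2.2))‖ ^ 2
      ≤ ∑ p, ∑ q, ‖X p q‖ ^ 2 := by
    have hb : ∑ p, ∑ q, ‖X p q‖ ^ 2 = ∑ t : (α × α) × (β × β), ∑ q, ‖X (e (t.1.1, t.2.1), e (t.1.2, t.2.2)) q‖ ^ 2 :=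
      (Equiv.sum_comp ((Equiv.prodProdProdComm α α β β).trans (Equiv.prodCongr e e))
        (fun p => ∑ q, ‖X p q‖ ^ 2)).symm
    rw [hb]
    refine Finset.sum_le_sum fun t _ => ?_
    exact Finset.single_le_sum (f := fun q => ‖X (e (t.1.1, t.2.1), e (t.1.2, t.2.2)) q‖ ^ 2)
      (fun _ _ => sq_nonneg _) (Finset.mem_univ _)
  have h0 : 0 ≤ ∑ p, ∑ q, ‖X p q‖ ^ 2 :=
    Finset.sum_nonneg fun _ _ => Finset.sum_nonneg fun _ _ => sq_nonneg _
  refine abs_le_of_sq_le_sq' ?_ ?_ |>.2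
  · refine h2.trans ?_
    rw [mul_pow, frobNorm, Real.sq_sqrt h0, Finset.card_univ]
    simp only [Fintype.card_prod]
    rw [hc]
    refine le_trans (mul_le_mul_of_nonneg_left h3 (by positivity)) (le_of_eq ?_)
    push_cast
    ring
  · unfold frobNorm; positivity

theorem auxS_one {α β γ : Type*} [Fintype α] [Fintype β] [Fintype γ] [DecidableEq γ]
    (e : α × β ≃ γ) :
    auxS e 1 = Fintype.card α * Fintype.card β ^ 2 := by
  classical
  unfold auxS
  simp only [Matrix.one_apply, Prod.mk.injEq, EmbeddingLike.apply_eq_iff_eq]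
  simp only [Fintype.sum_prod_type]
  have : ∀ x y : α, (x = y ∧ y = x) ↔ x = y := fun x y => ⟨fun h => h.1, fun h => ⟨h, h.symm⟩⟩
  simp [this, sq]

theorem auxS_swap {d n : ℕ} {α β : Type*} [Fintype α] [Fintype β]
    (e : α × β ≃ (Fin n → Fin d)) :
    auxS e (swapBig d n) = Fintype.card α ^ 2 * Fintype.card β := by
  classical
  unfold auxS swapBig
  simp only [Matrix.of_apply, Prod.mk.injEq, EmbeddingLike.apply_eq_iff_eq]
  simp only [Fintype.sum_prod_type]
  have : ∀ x y : β, (x = y ∧ y = x) ↔ x = y := fun x y => ⟨fun h => h.1, fun h => ⟨h, h.symm⟩⟩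
  simp [this]
  ring

theorem auxS_sub_smul {α β γ : Type*} [Fintype α] [Fintype β] (e : α × β ≃ γ)
    (X Y Z : Matrix (γ × γ) (γ × γ) ℂ) (c k : ℂ) :
    auxS e (X - c • k • (Y + Z)) = auxS e X - c * k * (auxS e Y + auxS e Z) := by
  simp only [auxS, Matrix.sub_apply, Matrix.smul_apply, Matrix.add_apply, smul_eq_mul,
    Finset.sum_sub_distrib, ← Finset.sum_add_distrib, Finset.mul_sum, mul_assoc]

/-- Merging as an equivalence. -/
def auxE {n : ℕ} (d : ℕ) (A : Finset (Fin n)) :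
    ((A → Fin d) × ((Aᶜ : Finset (Fin n)) → Fin d)) ≃ (Fin n → Fin d) where
  toFun p := mergeCfg A p.1 p.2
  invFun c := (fun i => c i, fun i => c i)
  left_inv p := by
    ext i
    · simp [mergeCfg]
    · have := Finset.mem_compl.mp i.2
      simp [mergeCfg, this]
  right_inv c := by
    ext i
    simp [mergeCfg]

theorem rhoA_herm {n d : ℕ} (A : Finset (Fin n)) (ψ : (Fin n → Fin d) → ℂ) :
    (rhoA A ψ).IsHermitian := by
  ext x y
  simp [rhoA, Matrix.conjTranspose_apply, mul_comm]

theorem rhoA_trace {n d : ℕ} (A : Finset (Fin n)) (ψ : UnitVec d n) :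
    (rhoA A ψ.1).trace = 1 := by
  have h := ψ.2
  rw [← Equiv.sum_comp (auxE d A), Fintype.sum_prod_type] at h
  have h' : ((∑ x, ∑ z, ‖ψ.1 (mergeCfg A x z)‖ ^ 2 : ℝ) : ℂ) = 1 := by
    exact_mod_cast h
  rw [← h']
  simp only [Matrix.trace, Matrix.diag, rhoA, Matrix.of_apply, Complex.mul_conj']
  push_cast
  rfl

theorem auxS_pure {n d : ℕ} (A : Finset (Fin n)) (ψ : (Fin n → Fin d) → ℂ) :
    auxS (auxE d A) (pureTwo ψ) = ((∑ x, ∑ y, ‖rhoA A ψ x y‖ ^ 2 : ℝ) : ℂ) := by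
  push_cast
  simp only [auxS, Fintype.sum_prod_type, ← Complex.mul_conj', rhoA, Matrix.of_apply, map_sum,
    Finset.sum_mul_sum, pureTwo, auxE, Equiv.coe_fn_mk]
  refine Finset.sum_congr rfl fun x _ => Finset.sum_congr rfl fun y _ =>
    Finset.sum_congr rfl fun z _ => Finset.sum_congr rfl fun w _ => ?_
  simp only [map_mul, Complex.conj_conj]
  ring

theorem pureTwo_integrable {d n : ℕ} (ν : Measure (UnitVec d n)) [IsProbabilityMeasure ν]
    (p q : (Fin n → Fin d) × (Fin n → Fin d)) :
    Integrable (fun ψ : UnitVec d n => pureTwo ψ.1 p q) ν := by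
  have hb : ∀ (ψ : UnitVec d n) x, ‖ψ.1 x‖ ≤ 1 := by
    intro ψ x
    have h := ψ.2
    have h2 := Finset.single_le_sum (f := fun x => ‖ψ.1 x‖ ^ 2)
      (fun _ _ => sq_nonneg _) (Finset.mem_univ x)
    rw [h] at h2
    exact (sq_le_one_iff₀ (norm_nonneg _)).1 h2
  have hm : ∀ x, Measurable fun ψ : UnitVec d n => ψ.1 x := fun x =>
    (measurable_pi_apply x).comp measurable_subtype_coe
  refine Integrable.of_bound (C := 1) (Measurable.aestronglyMeasurable ?_)
    (Filter.Eventually.of_forall fun ψ => ?_)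
  · simp only [pureTwo, Matrix.of_apply]
    have hc : ∀ x, Measurable fun ψ : UnitVec d n => conj (ψ.1 x) := fun x =>
      Complex.continuous_conj.measurable.comp (hm x)
    exact (((hm _).mul (hm _)).mul (hc _)).mul (hc _)
  · simp only [pureTwo, Matrix.of_apply, norm_mul, RCLike.norm_conj]
    exact mul_le_one₀ (mul_le_one₀ (mul_le_one₀ (hb _ _) (norm_nonneg _) (hb _ _))
      (norm_nonneg _) (hb _ _)) (norm_nonneg _) (hb _ _)

theorem moment_bound {d n : ℕ} (ν : Measure (UnitVec d n)) [IsProbabilityMeasure ν]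
    (A : Finset (Fin n)) (D : ℕ) (hD : 1 ≤ D)
    (hrank : ∀ᵐ ψ ∂ν, (rhoA A ψ.1).rank ≤ D) :
    1 / (D : ℝ) ≤ (auxS (auxE d A) (momentTwo ν)).re := by
  have hint : Integrable (fun ψ : UnitVec d n => auxS (auxE d A) (pureTwo ψ.1)) ν := by
    unfold auxS
    exact integrable_finsetSum _ fun t _ => pureTwo_integrable ν _ _
  have h1 : auxS (auxE d A) (momentTwo ν) = ∫ ψ, auxS (auxE d A) (pureTwo ψ.1) ∂ν := by
    unfold auxS
    rw [integral_finsetSum _ fun t _ => pureTwo_integrable ν _ _]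
    rfl
  simp only [auxS_pure] at h1 hint
  rw [h1, integral_complex_ofReal, Complex.ofReal_re]
  have hint' := hint.re
  simp only [RCLike.re_to_complex, Complex.ofReal_re] at hint'
  have h2 : ∫ _ψ : UnitVec d n, (1 / (D : ℝ)) ∂ν = 1 / (D : ℝ) := by simp
  rw [← h2]
  refine integral_mono_ae (integrable_const _) hint' ?_
  filter_upwards [hrank] with ψ hψ
  exact aux_purity _ (rhoA_herm A ψ.1) (rhoA_trace A ψ) D hD hψ

/-- obstruction to RMPS being approximate 2-designs.  Let `n ≥ 2` be even,
`A` the first half of the chain and `B` the second half.  If `ν` is a Borel probability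
measure on unit vectors of `(ℂ^d)^{⊗n}` such that ν-almost every `ψ` has Schmidt rank
at most `D` across `A|B` (i.e. `rank(Tr_B|ψ⟩⟨ψ|) ≤ D`), and
`‖E_ν (|ψ⟩⟨ψ|)^{⊗2} − 2 P_sym/(d^n(d^n+1))‖_F ≤ ε`, then
`ε ≥ d^{−n}(1/D − 2 d^{n/2}/(d^n+1))`. -/
theorem no_approx_two_design
    (d D n : ℕ) (hd : 2 ≤ d) (hD : 1 ≤ D) (hn : 2 ≤ n) (heven : 2 ∣ n)
    (ν : Measure (UnitVec d n)) [IsProbabilityMeasure ν]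
    (hrank : ∀ᵐ ψ ∂ν,
      (rhoA (Finset.univ.filter fun i : Fin n => (i : ℕ) < n / 2) ψ.1).rank ≤ D)
    (ε : ℝ)
    (hε : frobNorm (momentTwo ν -
        ((2 : ℂ) / ((d : ℂ) ^ n * ((d : ℂ) ^ n + 1))) • symProj d n) ≤ ε) :
    ((d : ℝ) ^ n)⁻¹ * (1 / (D : ℝ) - 2 * (d : ℝ) ^ (n / 2) / ((d : ℝ) ^ n + 1)) ≤ ε := by
  obtain ⟨m, rfl⟩ := heven
  have hm : 2 * m / 2 = m := by omega
  set A : Finset (Fin (2 * m)) :=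
    Finset.univ.filter fun i : Fin (2 * m) => (i : ℕ) < 2 * m / 2 with hA
  have hcA : A.card = m := by
    rw [hA, hm]
    rw [Fin.card_filter_val_lt]
    omega
  have hcB : (Aᶜ).card = m := by
    rw [Finset.card_compl, hcA, Fintype.card_fin]; omega
  have h1 := moment_bound ν A D hD hrank
  have h2 := auxS_le (auxE d A) (momentTwo ν -
        ((2 : ℂ) / ((d : ℂ) ^ (2 * m) * ((d : ℂ) ^ (2 * m) + 1))) • symProj d (2 * m))
  have h3 := (Complex.re_le_norm _).trans h2
  unfold symProj at h3 hε
  rw [auxS_sub_smul, auxS_one, auxS_swap] at h3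
  simp only [Fintype.card_pi, Fintype.card_fin, Finset.prod_const, Finset.card_univ,
    Fintype.card_coe, hcA, hcB] at h3
  have hdp : (0 : ℝ) < (d : ℝ) ^ m := by
    have : 0 < d := by omega
    positivity
  set a : ℝ := (d : ℝ) ^ m with ha
  have hN : (d : ℝ) ^ (2 * m) = a ^ 2 := by rw [ha, ← pow_mul, mul_comm]
  have hNc : (d : ℂ) ^ (2 * m) = ((a ^ 2 : ℝ) : ℂ) := by rw [← hN]; push_cast; rfl
  have hac : (((d ^ m : ℕ)) : ℂ) = (a : ℂ) := by rw [ha]; push_cast; rfl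
  have hnat : (((d ^ (2 * m) : ℕ)) : ℝ) = a ^ 2 := by rw [← hN]; push_cast; rfl
  have hval : (2 : ℂ) / ((d : ℂ) ^ (2 * m) * ((d : ℂ) ^ (2 * m) + 1)) * 2⁻¹ *
      (((d ^ m : ℕ) : ℂ) * ((d ^ m : ℕ) : ℂ) ^ 2 + ((d ^ m : ℕ) : ℂ) ^ 2 * ((d ^ m : ℕ) : ℂ))
      = ((2 * a / (a ^ 2 + 1) : ℝ) : ℂ) := by
    rw [hNc, hac]
    have e : (2 * a / (a ^ 2 + 1) : ℝ) =
      2 / (a ^ 2 * (a ^ 2 + 1)) * 2⁻¹ * (a * a ^ 2 + a ^ 2 * a) := by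
      field_simp
      ring
    rw [e]
    push_cast
    ring
  rw [hval, Complex.sub_re, Complex.ofReal_re, hnat] at h3
  rw [hm, hN, ← ha, inv_mul_le_iff₀ (by positivity)]
  have h4 := mul_le_mul_of_nonneg_left hε (sq_nonneg a)
  linarith
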